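/- Under the LWR setup with spinor x, let Φ0(z) := Φ(0,z), (u,v) := Φ0·x, g := u/v and q := u·v′ − v·u′. Assume v and q are nowhere vanishing on U (so g is holomorphic on U and g′ = −q/v² is nowhere vanishing) and that there exists a holomorphic η : U → ℂ with η² = g′. Then there exists a holomorphic k : U → M₂(ℂ) with det k ≡ 1 such that for all λ ∈ ℂ and z ∈ U: k(z)⁻¹·(λ·A(z) + B(z))·k(z) + k(z)⁻¹·k′(z) = ((0, 1),(λ·q(z) + s(z), 0)), where s := (g″/(2g′))² − (g″/(2g′))′ is the Schwarzian derivative of g. (Existence of the Schwarz form of the potential.) -/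

import Mathlib

open Matrix

attribute [local instance] Matrix.normedAddCommGroup Matrix.normedSpace

/-- 2×2 complex matrices. -/
abbrev M2 : Type := Matrix (Fin 2) (Fin 2) ℂ

/-- The matrix `x·x^⊥` associated with a spinor `x = (u,v)`. -/
noncomputable def spinMat (u v : ℂ) : M2 := !![-(u * v), u ^ 2; -(v ^ 2), u * v]

/-- `y(z) = Φ(0,z)·x(z)`, the spinor moved by the frame at `λ = 0`. -/
noncomputable def Yvec (Φ : ℂ → ℂ → M2) (xu xv : ℂ → ℂ) (w : ℂ) : Fin 2 → ℂ :=
  (Φ 0 w).mulVec ![xu w, xv w]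

/-- The Gauss map `g = u/v` built from the components of `y = Φ(0,·)·x`. -/
noncomputable def Gmap (Φ : ℂ → ℂ → M2) (xu xv : ℂ → ℂ) (w : ℂ) : ℂ :=
  Yvec Φ xu xv w 0 / Yvec Φ xu xv w 1

/-- The function `q = u·v′ − v·u′` built from the components of `y = Φ(0,·)·x`. -/
noncomputable def Qfun (Φ : ℂ → ℂ → M2) (xu xv : ℂ → ℂ) (z : ℂ) : ℂ :=
  Yvec Φ xu xv z 0 * deriv (fun w => Yvec Φ xu xv w 1) z
    - Yvec Φ xu xv z 1 * deriv (fun w => Yvec Φ xu xv w 0) z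

/-- The Schwarzian derivative `S[g] = (g″/(2g′))² − (g″/(2g′))′`. -/
noncomputable def schwarzian (g : ℂ → ℂ) (z : ℂ) : ℂ :=
  (deriv (deriv g) z / (2 * deriv g z)) ^ 2
    - deriv (fun w => deriv (deriv g) w / (2 * deriv g w)) z

theorem hasDerivAt_matrix_iff {f : ℂ → M2} {f' : M2} {z : ℂ} :
    HasDerivAt f f' z ↔ ∀ i j, HasDerivAt (fun w => f w i j) (f' i j) z := by
  constructor
  · intro h i j
    exact hasDerivAt_pi.1 (hasDerivAt_pi.1 h i) j
  · intro h
    exact hasDerivAt_pi.2 fun i => hasDerivAt_pi.2 fun j => h i j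

theorem HasDerivAt.matrix_two_mul {f h : ℂ → M2} {f' h' : M2} {z : ℂ}
    (hf : HasDerivAt f f' z) (hh : HasDerivAt h h' z) :
    HasDerivAt (fun w => f w * h w) (f' * h z + f z * h') z := by
  rw [hasDerivAt_matrix_iff] at hf hh ⊢
  intro i j
  simp only [Matrix.mul_apply, Fin.sum_univ_two, Matrix.add_apply]
  exact (((hf i 0).mul (hh 0 j)).add ((hf i 1).mul (hh 1 j))).congr_deriv (by ring)

theorem HasDerivAt.adjugate_two {f : ℂ → M2} {f' : M2} {z : ℂ} (hf : HasDerivAt f f' z) :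
    HasDerivAt (fun w => (f w).adjugate) f'.adjugate z := by
  rw [hasDerivAt_matrix_iff] at hf ⊢
  intro i j
  simp only [Matrix.adjugate_fin_two]
  fin_cases i <;> fin_cases j
  · exact hf 1 1
  · exact (hf 0 1).neg
  · exact (hf 1 0).neg
  · exact hf 0 0

theorem adjugate_eq_neg_of_trace_eq_zero {B : M2} (h : B.trace = 0) : B.adjugate = -B := by
  rw [Matrix.trace_fin_two] at h
  ext i j
  fin_cases i <;> fin_cases j <;> simp [Matrix.adjugate_fin_two] <;> linear_combination h

/-- Conjugating `x·x^⊥` by `P` gives the spinor matrix of `P·x`. -/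
theorem mul_spinMat_mul_adjugate (P : M2) (a b : ℂ) :
    P * spinMat a b * P.adjugate
      = spinMat ((P.mulVec ![a, b]) 0) ((P.mulVec ![a, b]) 1) := by
  ext i j
  fin_cases i <;> fin_cases j <;>
    simp [spinMat, Matrix.adjugate_fin_two, Matrix.mul_apply, Fin.sum_univ_two,
      Matrix.mulVec, dotProduct] <;> ring

/-- The gauge action of `P⁻¹ M` on `μA + B`, when `P' = P B` and `M' = M S`. -/
theorem gauge_adjugate_mul {P M : M2} (A B S : M2) (μ : ℂ) (hP : P.det = 1) (hM : M.det = 1) :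
    (P.adjugate * M)⁻¹ * (μ • A + B) * (P.adjugate * M)
        + (P.adjugate * M)⁻¹ * (-B * P.adjugate * M + P.adjugate * (M * S))
      = μ • (M.adjugate * (P * A * P.adjugate) * M) + S := by
  have hPP : P * P.adjugate = 1 := by rw [Matrix.mul_adjugate, hP, one_smul]
  have hMM : M.adjugate * M = 1 := by rw [Matrix.adjugate_mul, hM, one_smul]
  have hinv : (P.adjugate * M)⁻¹ = M.adjugate * P := by
    apply Matrix.inv_eq_left_inv
    rw [Matrix.mul_assoc, ← Matrix.mul_assoc P, hPP, Matrix.one_mul, hMM]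
  have hS : M.adjugate * P * (P.adjugate * (M * S)) = S := by
    rw [Matrix.mul_assoc, ← Matrix.mul_assoc P, hPP, Matrix.one_mul, ← Matrix.mul_assoc, hMM,
      Matrix.one_mul]
  rw [hinv, Matrix.mul_add (M.adjugate * P) (-B * P.adjugate * M), hS]
  simp only [Matrix.mul_add, Matrix.add_mul, Matrix.mul_smul, Matrix.smul_mul, Matrix.neg_mul,
    Matrix.mul_neg, Matrix.mul_assoc]
  abel

/-- The frame built from the solutions `g/η`, `1/η` of `y″ = S[g]·y`, where `g′ = η²` and
`p = η′/η`. -/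
noncomputable def schwarzFrame (g η p : ℂ → ℂ) (z : ℂ) : M2 :=
  !![η z - g z * p z / η z, g z / η z; -(p z / η z), 1 / η z]

theorem det_schwarzFrame {g η p : ℂ → ℂ} {z : ℂ} (hη : η z ≠ 0) :
    (schwarzFrame g η p z).det = 1 := by
  rw [schwarzFrame, Matrix.det_fin_two_of]
  field_simp
  ring

theorem hasDerivAt_schwarzFrame {g η p : ℂ → ℂ} {p' z : ℂ} (hη0 : η z ≠ 0)
    (hg : HasDerivAt g (η z ^ 2) z) (hη : HasDerivAt η (p z * η z) z) (hp : HasDerivAt p p' z) :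
    HasDerivAt (schwarzFrame g η p)
      (schwarzFrame g η p z * !![0, 1; p z ^ 2 - p', 0]) z := by
  rw [hasDerivAt_matrix_iff]
  intro i j
  fin_cases i <;> fin_cases j <;>
    simp only [schwarzFrame, Matrix.mul_apply, Fin.sum_univ_two, Fin.zero_eta, Fin.mk_one,
      Matrix.of_apply, Matrix.cons_val', Matrix.cons_val_zero, Matrix.cons_val_one,
      Matrix.cons_val_fin_one]
  · refine (hη.sub ((hg.mul hp).div hη hη0)).congr_deriv ?_
    simp only [Pi.mul_apply]
    field_simp
    ring
  · refine (hg.div hη hη0).congr_deriv ?_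
    field_simp
    ring
  · refine (hp.div hη hη0).neg.congr_deriv ?_
    field_simp
    ring
  · refine ((hasDerivAt_const z (1 : ℂ)).div hη hη0).congr_deriv ?_
    field_simp
    ring

theorem adjugate_schwarzFrame_mul_spinMat {g η p : ℂ → ℂ} {u v q z : ℂ} (hη0 : η z ≠ 0)
    (hv : v ≠ 0) (hg : g z = u / v) (hq : η z ^ 2 = -q / v ^ 2) :
    (schwarzFrame g η p z).adjugate * spinMat u v * schwarzFrame g η p z = !![0, 0; q, 0] := by
  have hq' : q = -(η z ^ 2 * v ^ 2) := by rw [hq]; field_simp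
  ext i j
  fin_cases i <;> fin_cases j <;>
    simp [schwarzFrame, spinMat, Matrix.adjugate_fin_two, Matrix.mul_apply, Fin.sum_univ_two,
      hg, hq'] <;> field_simp <;> ring

theorem differentiableAt_Yvec {Φ : ℂ → ℂ → M2} {xu xv : ℂ → ℂ} {z : ℂ}
    (hΦ : DifferentiableAt ℂ (Φ 0) z) (hxu : DifferentiableAt ℂ xu z)
    (hxv : DifferentiableAt ℂ xv z) (i : Fin 2) :
    DifferentiableAt ℂ (fun w => Yvec Φ xu xv w i) z := by
  have h := hasDerivAt_matrix_iff.1 hΦ.hasDerivAt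
  simp only [Yvec, Matrix.mulVec, dotProduct, Fin.sum_univ_two, Matrix.cons_val_zero,
    Matrix.cons_val_one, Matrix.cons_val_fin_one]
  exact ((h i 0).differentiableAt.mul hxu).add ((h i 1).differentiableAt.mul hxv)

theorem hasDerivAt_Gmap {Φ : ℂ → ℂ → M2} {xu xv : ℂ → ℂ} {z : ℂ}
    (hY : ∀ i, DifferentiableAt ℂ (fun w => Yvec Φ xu xv w i) z) (hv : Yvec Φ xu xv z 1 ≠ 0) :
    HasDerivAt (Gmap Φ xu xv) (-Qfun Φ xu xv z / Yvec Φ xu xv z 1 ^ 2) z := by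
  refine ((hY 0).hasDerivAt.div (hY 1).hasDerivAt hv).congr_deriv ?_
  rw [Qfun]
  ring

/-- If `g′ = η²` on an open set, then `g″/(2g′) = η′/η` there. -/
theorem deriv_deriv_div_eq {U : Set ℂ} (hU : IsOpen U) {g η : ℂ → ℂ}
    (hη : DifferentiableOn ℂ η U) (hη0 : ∀ z ∈ U, η z ≠ 0)
    (hg : ∀ z ∈ U, η z ^ 2 = deriv g z) {z : ℂ} (hz : z ∈ U) :
    deriv (deriv g) z / (2 * deriv g z) = deriv η z / η z := by
  have hev : deriv g =ᶠ[nhds z] fun w => η w ^ 2 := by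
    filter_upwards [hU.mem_nhds hz] with w hw using (hg w hw).symm
  have h := ((hη.differentiableAt (hU.mem_nhds hz)).hasDerivAt.pow 2).deriv
  have h0 := hη0 z hz
  rw [hev.deriv_eq, ← hg z hz]
  change deriv (η ^ 2) z / _ = _
  rw [h]
  field_simp
  norm_num
  ring

theorem schwarzian_eq {U : Set ℂ} (hU : IsOpen U) {g η : ℂ → ℂ}
    (hη : DifferentiableOn ℂ η U) (hη0 : ∀ z ∈ U, η z ≠ 0)
    (hg : ∀ z ∈ U, η z ^ 2 = deriv g z) {z : ℂ} (hz : z ∈ U) :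
    schwarzian g z = (deriv η z / η z) ^ 2 - deriv (fun w => deriv η w / η w) z := by
  have hev : (fun w => deriv (deriv g) w / (2 * deriv g w)) =ᶠ[nhds z]
      fun w => deriv η w / η w := by
    filter_upwards [hU.mem_nhds hz] with w hw using deriv_deriv_div_eq hU hη hη0 hg hw
  rw [schwarzian, deriv_deriv_div_eq hU hη hη0 hg hz, hev.deriv_eq]

/-- existence of the Schwarz form: with `u,v` the components of
`Φ(0,·)x`, `g = u/v`, `q = u v′ − v u′`, if `v` and `q` are nowhere vanishing on
`U` and `g′` admits a holomorphic square root `η` on `U`, then there is a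
holomorphic gauge `k` with `det k ≡ 1` taking the potential `λA + B` to the
Schwarz form `((0,1),(λq + s,0))`, where `s = S[g]` is the Schwarzian derivative
of `g`. -/
theorem lwr_schwarz_potential_exists
    (U : Set ℂ) (hU : IsOpen U)
    (A B : ℂ → M2) (Φ : ℂ → ℂ → M2)
    (xu xv xu' xv' : ℂ → ℂ)
    (hxu : ∀ z ∈ U, HasDerivAt xu (xu' z) z)
    (hxv : ∀ z ∈ U, HasDerivAt xv (xv' z) z)
    (hspin : ∀ z ∈ U, A z = spinMat (xu z) (xv z))
    (hB : DifferentiableOn ℂ B U)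
    (htrB : ∀ z ∈ U, (B z).trace = 0)
    (hΦ : DifferentiableOn ℂ (fun p : ℂ × ℂ => Φ p.1 p.2) (Set.univ ×ˢ U))
    (hΦdet : ∀ μ : ℂ, ∀ z ∈ U, (Φ μ z).det = 1)
    (hΦz : ∀ μ : ℂ, ∀ z ∈ U, HasDerivAt (fun w => Φ μ w) (Φ μ z * (μ • A z + B z)) z)
    (hv : ∀ z ∈ U, Yvec Φ xu xv z 1 ≠ 0)
    (hq : ∀ z ∈ U, Qfun Φ xu xv z ≠ 0)
    (η : ℂ → ℂ) (hη : DifferentiableOn ℂ η U)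
    (hη2 : ∀ z ∈ U, (η z) ^ 2 = deriv (Gmap Φ xu xv) z) :
    ∃ k k' : ℂ → M2,
      (∀ z ∈ U, HasDerivAt k (k' z) z) ∧
      (∀ z ∈ U, (k z).det = 1) ∧
      ∀ μ : ℂ, ∀ z ∈ U,
        (k z)⁻¹ * (μ • A z + B z) * k z + (k z)⁻¹ * k' z
          = !![0, 1; μ * Qfun Φ xu xv z + schwarzian (Gmap Φ xu xv) z, 0] := by
  have hΦ0 : ∀ z ∈ U, HasDerivAt (Φ 0) (Φ 0 z * B z) z := by
    intro z hz
    simpa using hΦz 0 z hz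
  have hG : ∀ z ∈ U,
      HasDerivAt (Gmap Φ xu xv) (-Qfun Φ xu xv z / Yvec Φ xu xv z 1 ^ 2) z := fun z hz =>
    hasDerivAt_Gmap (differentiableAt_Yvec (hΦ0 z hz).differentiableAt
      (hxu z hz).differentiableAt (hxv z hz).differentiableAt) (hv z hz)
  have hηq : ∀ z ∈ U, η z ^ 2 = -Qfun Φ xu xv z / Yvec Φ xu xv z 1 ^ 2 := fun z hz =>
    (hη2 z hz).trans (hG z hz).deriv
  have hη0 : ∀ z ∈ U, η z ≠ 0 := by
    intro z hz h
    have h' : -Qfun Φ xu xv z / Yvec Φ xu xv z 1 ^ 2 ≠ 0 :=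
      div_ne_zero (neg_ne_zero.2 (hq z hz)) (pow_ne_zero 2 (hv z hz))
    rw [← hηq z hz, h] at h'
    simp at h'
  let p : ℂ → ℂ := fun w => deriv η w / η w
  let M : ℂ → M2 := schwarzFrame (Gmap Φ xu xv) η p
  let S : ℂ → M2 := fun z => !![0, 1; schwarzian (Gmap Φ xu xv) z, 0]
  have hM : ∀ z ∈ U, HasDerivAt M (M z * S z) z := by
    intro z hz
    have hηz := hη.differentiableAt (hU.mem_nhds hz)
    have hp : DifferentiableAt ℂ p z :=
      ((hη.deriv hU).differentiableAt (hU.mem_nhds hz)).div hηz (hη0 z hz)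
    simp only [S, schwarzian_eq hU hη hη0 hη2 hz]
    refine hasDerivAt_schwarzFrame (hη0 z hz) ?_ ?_ hp.hasDerivAt
    · rw [hηq z hz]
      exact hG z hz
    · rw [div_mul_cancel₀ _ (hη0 z hz)]
      exact hηz.hasDerivAt
  refine ⟨fun z => (Φ 0 z).adjugate * M z,
    fun z => -B z * (Φ 0 z).adjugate * M z + (Φ 0 z).adjugate * (M z * S z), ?_, ?_, ?_⟩
  · intro z hz
    have h := (hΦ0 z hz).adjugate_two
    rw [Matrix.adjugate_mul_distrib, adjugate_eq_neg_of_trace_eq_zero (htrB z hz)] at h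
    exact h.matrix_two_mul (hM z hz)
  · intro z hz
    simp [Matrix.det_mul, Matrix.det_adjugate, hΦdet 0 z hz, M, det_schwarzFrame (hη0 z hz)]
  · intro μ z hz
    rw [gauge_adjugate_mul _ _ _ _ (hΦdet 0 z hz) (det_schwarzFrame (hη0 z hz)), hspin z hz,
      mul_spinMat_mul_adjugate]
    have h := adjugate_schwarzFrame_mul_spinMat (p := p) (hη0 z hz) (hv z hz)
      (show Gmap Φ xu xv z = Yvec Φ xu xv z 0 / Yvec Φ xu xv z 1 from rfl) (hηq z hz)
    have h' : μ • ((M z).adjugate * spinMat (Yvec Φ xu xv z 0) (Yvec Φ xu xv z 1) * M z) + S z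
        = !![0, 1; μ * Qfun Φ xu xv z + schwarzian (Gmap Φ xu xv) z, 0] := by
      rw [h]
      simp [S]
    exact h'
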